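/- Let K₀ be a nonzero real constant and I, J ⊆ ℝ open intervals. There do not exist smooth functions f : I → ℝ and g : J → ℝ with f affine and nonconstant (f'(y) = f₀ ≠ 0) such that (f(y)g'(z))² − (f'(y)g(z))² ≠ 0 and f(y)g(z)f''(y)g''(z) − (f'(y)g'(z))² = K₀·((f(y)g'(z))² − (f'(y)g(z))²)² for all (y,z) ∈ I×J. Equivalently, the identity K₀(g'(z))⁴·f(y)⁴ − 2K₀(f₀ g(z) g'(z))²·f(y)² + (f₀ g(z))⁴ + (f₀ g'(z))² = 0 for all (y,z) is impossible. -/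

import Mathlib

/-- First case in the proof of nonexistence of second-kind factorable surfaces with
constant nonzero Gaussian curvature: `f` cannot be affine nonconstant. -/
theorem no_factorable_second_kind_f_affine_constant_gauss_curvature
    (K₀ : ℝ) (hK₀ : K₀ ≠ 0)
    (I J : Set ℝ) (hIo : IsOpen I) (hIc : I.OrdConnected) (hIn : I.Nonempty)
    (hJo : IsOpen J) (hJc : J.OrdConnected) (hJn : J.Nonempty)
    (f g : ℝ → ℝ) (hf : ContDiffOn ℝ (⊤ : ℕ∞) f I) (hg : ContDiffOn ℝ (⊤ : ℕ∞) g J)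
    (f₀ : ℝ) (hf₀ : f₀ ≠ 0) (haff : ∀ y ∈ I, deriv f y = f₀)
    (hnl : ∀ y ∈ I, ∀ z ∈ J, (f y * deriv g z) ^ 2 - (deriv f y * g z) ^ 2 ≠ 0)
    (heq : ∀ y ∈ I, ∀ z ∈ J,
      f y * g z * deriv (deriv f) y * deriv (deriv g) z - (deriv f y * deriv g z) ^ 2
        = K₀ * ((f y * deriv g z) ^ 2 - (deriv f y * g z) ^ 2) ^ 2) :
    False := by
  have hder : ∀ y ∈ I, HasDerivAt f f₀ y := fun y hy => by
    have hd : DifferentiableAt ℝ f y :=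
      differentiableAt_of_deriv_ne_zero (by rw [haff y hy]; exact hf₀)
    simpa [haff y hy] using hd.hasDerivAt
  have hderiv₂ : ∀ y ∈ I, deriv (deriv f) y = 0 := fun y hy => by
    have he : deriv f =ᶠ[nhds y] fun _ => f₀ :=
      Filter.eventually_of_mem (hIo.mem_nhds hy) haff
    rw [he.deriv_eq, deriv_const]
  obtain ⟨z, hz⟩ := hJn
  obtain ⟨y₀, hy₀⟩ := hIn
  have hnl' : ∀ y ∈ I, (f y * deriv g z) ^ 2 - (f₀ * g z) ^ 2 ≠ 0 := fun y hy => by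
    simpa only [haff y hy] using hnl y hy z hz
  have hcurv : ∀ y ∈ I, -(f₀ * deriv g z) ^ 2
      = K₀ * ((f y * deriv g z) ^ 2 - (f₀ * g z) ^ 2) ^ 2 := fun y hy => by
    have h := heq y hy z hz
    rw [hderiv₂ y hy, haff y hy] at h
    linarith
  have hg' : deriv g z ≠ 0 := fun h0 => by
    have h : K₀ * ((f y₀ * deriv g z) ^ 2 - (f₀ * g z) ^ 2) ^ 2 = 0 := by
      rw [← hcurv y₀ hy₀, h0]
      ring
    exact mul_ne_zero hK₀ (pow_ne_zero 2 (hnl' y₀ hy₀)) h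
  -- Differentiating the curvature identity in `y` forces `f` to vanish on `I`.
  have hf_zero : ∀ y ∈ I, f y = 0 := fun y hy => by
    have h₁ := (((((hder y hy).mul_const (deriv g z)).fun_pow 2).sub_const
      ((f₀ * g z) ^ 2)).fun_pow 2).const_mul K₀
    have he : (fun y => K₀ * ((f y * deriv g z) ^ 2 - (f₀ * g z) ^ 2) ^ 2)
        =ᶠ[nhds y] fun _ => -(f₀ * deriv g z) ^ 2 :=
      Filter.eventually_of_mem (hIo.mem_nhds hy) fun x hx => (hcurv x hx).symm
    have h₂ := h₁.unique ((hasDerivAt_const y _).congr_of_eventuallyEq he)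
    have h₃ : (4 * K₀ * f₀ * deriv g z ^ 2 * ((f y * deriv g z) ^ 2 - (f₀ * g z) ^ 2)) * f y
        = 0 := by
      rw [← h₂]
      norm_num
      ring
    refine (mul_eq_zero.mp h₃).resolve_left ?_
    have := hnl' y hy
    positivity
  have he : f =ᶠ[nhds y₀] fun _ => 0 := Filter.eventually_of_mem (hIo.mem_nhds hy₀) hf_zero
  exact hf₀ ((hder y₀ hy₀).unique ((hasDerivAt_const y₀ 0).congr_of_eventuallyEq he))
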